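/- Let α ∈ (1/2, 1/√2), δ_α = 1/4 − α/(2√2), ε_α = 1/(4α) − 1/(2√2), R₀ = [−2,2]×[−√2,√2], R_ε = [−2−ε_α, 2+ε_α]×[−√2−ε_α, √2+ε_α], and let B denote the closure of R_ε \ (R₀ ∩ ({x : x₁ ≥ δ_α} ∪ {x : x₁ ≤ −δ_α})). Then for any two distinct finite words w, w' ∈ {1,2}* and every s ∈ [0, δ_α], the sets F_w^s(B) and F_{w'}^s(B) are disjoint. -/

import Mathlib

open Set

noncomputable section

/-- Rotation by `π/2` about the origin. -/
def Rot (x : ℝ × ℝ) : ℝ × ℝ := (-x.2, x.1)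

/-- The time-dependent affine map `F₁ˢ x = (1 - s, 0) + α R x`. -/
def F1s (α s : ℝ) (x : ℝ × ℝ) : ℝ × ℝ := ((1 : ℝ) - s, 0) + α • Rot x

/-- The time-dependent affine map `F₂ˢ x = (-1 + s, 0) + α R x`. -/
def F2s (α s : ℝ) (x : ℝ × ℝ) : ℝ × ℝ := ((-1 : ℝ) + s, 0) + α • Rot x

/-- `F₁ˢ` or `F₂ˢ`, indexed by a letter of the alphabet `{1, 2}` (as a `Bool`,
`true ↦ F₁ˢ`, `false ↦ F₂ˢ`). -/
def Fbs (α s : ℝ) (b : Bool) : ℝ × ℝ → ℝ × ℝ := if b then F1s α s else F2s α s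

/-- For a finite word `w = (w₁, …, w_k)` (a `List Bool`), the composition
`F_wˢ = F_{w₁}ˢ ∘ … ∘ F_{w_k}ˢ`; the empty word gives the identity. -/
def Fws (α s : ℝ) (w : List Bool) : ℝ × ℝ → ℝ × ℝ :=
  w.foldr (fun b f => Fbs α s b ∘ f) id

/-- The rectangle `R₀ = [-2,2] × [-√2,√2]`. -/
def R0 : Set (ℝ × ℝ) := Icc (-2 : ℝ) 2 ×ˢ Icc (-(Real.sqrt 2)) (Real.sqrt 2)

/-- The enlarged rectangle `R_ε = [-2-ε, 2+ε] × [-√2-ε, √2+ε]`. -/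
def Re (ε : ℝ) : Set (ℝ × ℝ) :=
  Icc (-2 - ε) (2 + ε) ×ˢ Icc (-(Real.sqrt 2) - ε) (Real.sqrt 2 + ε)

theorem Fbs_injective {α : ℝ} (h : α ≠ 0) (s : ℝ) (b : Bool) :
    Function.Injective (Fbs α s b) := by
  rintro ⟨x₁, x₂⟩ ⟨y₁, y₂⟩ hxy
  cases b <;> simp_all [Fbs, F1s, F2s, Rot]

theorem Fws_cons (α s : ℝ) (b : Bool) (w : List Bool) (S : Set (ℝ × ℝ)) :
    Fws α s (b :: w) '' S = Fbs α s b '' (Fws α s w '' S) := by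
  rw [← image_comp]
  rfl

theorem Fws_image_subset {α s : ℝ} {S : Set (ℝ × ℝ)} (h : ∀ b, MapsTo (Fbs α s b) S S)
    (w : List Bool) : Fws α s w '' S ⊆ S := by
  induction w with
  | nil => simp [Fws]
  | cons b w ih =>
    rw [Fws_cons]
    exact (image_mono ih).trans (h b).image_subset

/-- If `S` is mapped into itself by both maps, with disjoint images which both avoid `B ⊆ S`,
then the images of `B` under distinct words are disjoint. -/
theorem disjoint_Fws_image {α s : ℝ} (hα : α ≠ 0) {B S : Set (ℝ × ℝ)} (hBS : B ⊆ S)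
    (hS : ∀ b, MapsTo (Fbs α s b) S S)
    (hdisj : Disjoint (Fbs α s true '' S) (Fbs α s false '' S))
    (hB : ∀ b, Disjoint B (Fbs α s b '' S)) :
    ∀ w w' : List Bool, w ≠ w' → Disjoint (Fws α s w '' B) (Fws α s w' '' B) := by
  have hw (w : List Bool) : Fws α s w '' B ⊆ S :=
    (image_mono hBS).trans (Fws_image_subset hS w)
  have hnil (b : Bool) (w : List Bool) :
      Disjoint (Fws α s [] '' B) (Fws α s (b :: w) '' B) := by
    rw [Fws_cons]
    simpa [Fws] using (hB b).mono_right (image_mono (hw w))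
  intro w
  induction w with
  | nil =>
    rintro (_ | ⟨b, w'⟩) hne
    · exact absurd rfl hne
    · exact hnil b w'
  | cons a w ih =>
    rintro (_ | ⟨b, w'⟩) hne
    · exact (hnil a w).symm
    · by_cases hab : a = b
      · subst hab
        rw [Fws_cons, Fws_cons, disjoint_image_iff (Fbs_injective hα s a)]
        exact ih w' fun h => hne (h ▸ rfl)
      · rw [Fws_cons, Fws_cons]
        refine Disjoint.mono (image_mono (hw w)) (image_mono (hw w')) ?_
        cases a <;> cases b
        · exact absurd rfl hab
        · exact hdisj.symm
        · exact hdisj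
        · exact absurd rfl hab

/-- Under the relations `√2 α = 1 - 4δ` and `α ε = δ`, the image of `R_ε` under either map lies in
the interior of the corresponding part of `R₀ ∩ {|x₁| ≥ δ}`. -/
theorem Fbs_mem_of_mem_Re {α δ ε s : ℝ} (hα : 0 < α) (hδ : 0 < δ)
    (hαδ : α * Real.sqrt 2 = 1 - 4 * δ) (hαε : α * ε = δ) (hs : s ∈ Icc 0 δ)
    {x : ℝ × ℝ} (hx : x ∈ Re ε) (b : Bool) :
    Fbs α s b x ∈ (if b then Ioo δ 2 else Ioo (-2) (-δ)) ×ˢ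
      Ioo (-(Real.sqrt 2)) (Real.sqrt 2) := by
  obtain ⟨x₁, x₂⟩ := x
  obtain ⟨⟨h₁, h₂⟩, h₃, h₄⟩ := hx
  obtain ⟨hs₀, hs₁⟩ := hs
  simp only at h₁ h₂ h₃ h₄
  have h2 : Real.sqrt 2 * Real.sqrt 2 = 2 := Real.mul_self_sqrt zero_le_two
  have h1 : 1 < Real.sqrt 2 := by
    rw [Real.lt_sqrt] <;> norm_num
  have hα2 : 2 * α = Real.sqrt 2 - 4 * (Real.sqrt 2 * δ) := by
    linear_combination Real.sqrt 2 * hαδ - α * h2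
  have hδ2 : δ < Real.sqrt 2 * δ := lt_mul_of_one_lt_left hδ h1
  have k₁ := mul_le_mul_of_nonneg_left h₁ hα.le
  have k₂ := mul_le_mul_of_nonneg_left h₂ hα.le
  have k₃ := mul_le_mul_of_nonneg_left h₃ hα.le
  have k₄ := mul_le_mul_of_nonneg_left h₄ hα.le
  cases b <;> simp [Fbs, F1s, F2s, Rot] <;> refine ⟨⟨?_, ?_⟩, ?_, ?_⟩ <;> linarith

/-- Let `B` be the closure of
`R_ε \ (R₀ ∩ ({x₁ ≥ δ_α} ∪ {x₁ ≤ -δ_α}))`. For any two distinct finite words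
`w, w'` and every `s ∈ [0, δ_α]`, the sets `F_wˢ(B)` and `F_{w'}ˢ(B)` are disjoint. -/
theorem statement13 (α : ℝ) (hα : α ∈ Ioo (1/2 : ℝ) (Real.sqrt 2)⁻¹)
    (δ ε : ℝ) (hδ : δ = 1/4 - α / (2 * Real.sqrt 2))
    (hε : ε = 1 / (4 * α) - 1 / (2 * Real.sqrt 2))
    (B : Set (ℝ × ℝ))
    (hB : B = closure (Re ε \ (R0 ∩ ({x : ℝ × ℝ | δ ≤ x.1} ∪ {x : ℝ × ℝ | x.1 ≤ -δ})))) :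
    ∀ w w' : List Bool, w ≠ w' → ∀ s ∈ Icc (0 : ℝ) δ,
      Disjoint (Fws α s w '' B) (Fws α s w' '' B) := by
  obtain ⟨hα₁, hα₂⟩ := hα
  have hα₀ : 0 < α := by linarith
  have h2 : Real.sqrt 2 * Real.sqrt 2 = 2 := Real.mul_self_sqrt zero_le_two
  have hr : 0 < Real.sqrt 2 := by positivity
  have hαδ : α * Real.sqrt 2 = 1 - 4 * δ := by
    rw [hδ]
    field_simp
    linear_combination 2 * α * h2
  have hαε : α * ε = δ := by
    rw [hε, hδ]
    field_simp
  have hlt : α * Real.sqrt 2 < 1 := by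
    simpa [hr.ne'] using mul_lt_mul_of_pos_right hα₂ hr
  have hδ₀ : 0 < δ := by linarith
  have hε₀ : 0 < ε := pos_of_mul_pos_right (hαε ▸ hδ₀) hα₀.le
  have hBRe : B ⊆ Re ε := by
    rw [hB]
    exact closure_minimal sdiff_subset (isClosed_Icc.prod isClosed_Icc)
  have hBU (U : Set (ℝ × ℝ)) (hU : IsOpen U)
      (hsub : U ⊆ R0 ∩ ({x : ℝ × ℝ | δ ≤ x.1} ∪ {x : ℝ × ℝ | x.1 ≤ -δ})) : Disjoint B U := by
    rw [hB]
    exact (disjoint_sdiff_left.mono_right hsub).closure_left hU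
  intro w w' hne s hs
  have key (b : Bool) : Fbs α s b '' Re ε ⊆ (if b then Ioo δ 2 else Ioo (-2) (-δ)) ×ˢ
      Ioo (-(Real.sqrt 2)) (Real.sqrt 2) := by
    rintro _ ⟨x, hx, rfl⟩
    exact Fbs_mem_of_mem_Re hα₀ hδ₀ hαδ hαε hs hx b
  refine disjoint_Fws_image hα₀.ne' hBRe (fun b x hx => ?_) ?_ (fun b => ?_) w w' hne
  · obtain ⟨h, h₃, h₄⟩ := key b ⟨x, hx, rfl⟩
    cases b <;> obtain ⟨h₁, h₂⟩ := h <;>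
      refine ⟨⟨?_, ?_⟩, ?_, ?_⟩ <;> linarith
  · rw [disjoint_left]
    intro x hx hx'
    have h₁ : δ < x.1 := (key true hx).1.1
    have h₂ : x.1 < -δ := (key false hx').1.2
    linarith
  · refine (hBU _ ?_ ?_).mono_right (key b)
    · cases b <;> exact isOpen_Ioo.prod isOpen_Ioo
    · rintro x ⟨h, h₃, h₄⟩
      cases b <;> obtain ⟨h₁, h₂⟩ := h
      · exact ⟨⟨⟨h₁.le, by linarith⟩, h₃.le, h₄.le⟩, Or.inr h₂.le⟩
      · exact ⟨⟨⟨by linarith, h₂.le⟩, h₃.le, h₄.le⟩, Or.inl h₁.le⟩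

end
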